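/- Let G be a finitely generated group with the property that every subgroup of G of finite index equals G (i.e., G has no proper subgroups of finite index, equivalently the maximal residually finite quotient of G is trivial). Then for every field F and every natural number n, every group homomorphism ρ : G → GL_n(F) is trivial: ρ(g) = 1 for all g ∈ G. In particular every finite-dimensional representation of G over ℝ or ℂ is trivial. -/

import Mathlib

universe u

theorem Int.isJacobsonRing : IsJacobsonRing ℤ := by
  refine isJacobsonRing_iff_prime_eq.mpr fun P hP => ?_
  by_cases hbot : P = ⊥
  · subst hbot
    refine (Submodule.eq_bot_iff _).mpr fun x hx => ?_
    have hu := Ideal.mem_jacobson_bot.mp hx x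
    rcases Int.isUnit_iff.mp hu with h | h <;> nlinarith
  · have := hP.isMaximal hbot
    exact Ideal.jacobson_eq_self_of_isMaximal

/-- A field that is finitely generated as a ring is finite. -/
theorem Field.finite_of_finiteType_int (K : Type*) [Field K] [inst : Algebra ℤ K]
    [Algebra.FiniteType ℤ K] :
    Finite K := by
  obtain rfl : inst = Ring.toIntAlgebra K := Subsingleton.elim _ _
  have := Int.isJacobsonRing
  have hfin : Module.Finite ℤ K := finite_of_finite_type_of_isJacobsonRing ℤ K
  obtain ⟨p, hp⟩ := CharP.exists K
  rcases CharP.char_is_prime_or_zero K p with hprime | rfl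
  · have := Fact.mk hprime
    let := ZMod.algebra K p
    have : Module.Finite (ZMod p) K := Module.Finite.of_restrictScalars_finite ℤ _ _
    exact Module.finite_of_finite (ZMod p)
  · have := CharP.charP_to_charZero K
    exact absurd (isField_of_isIntegral_of_isField (R := ℤ) (S := K)
      (FaithfulSMul.algebraMap_injective ℤ K) (Field.toIsField K)) Int.not_isField

theorem IsDomain.eq_zero_of_forall_mem_isMaximal {A : Type*} [CommRing A] [IsDomain A]
    [IsJacobsonRing A] {x : A} (hx : ∀ m : Ideal A, m.IsMaximal → x ∈ m) : x = 0 := by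
  have hjac : (⊥ : Ideal A).jacobson = ⊥ :=
    isJacobsonRing_iff_prime_eq.mp ‹_› ⊥ Ideal.isPrime_bot
  rw [← Ideal.mem_bot, ← hjac]
  exact Submodule.mem_sInf.mpr fun m hm => hx m hm.2

/-- A homomorphism to a finite monoid is trivial on a group without proper subgroups of
finite index. -/
theorem MonoidHom.eq_one_of_finite {G M : Type*} [Group G] [Monoid M] [Finite M]
    (h : ∀ H : Subgroup G, H.FiniteIndex → H = ⊤) (f : G →* M) (g : G) : f g = 1 := by
  have hg : g ∈ f.toHomUnits.ker := by
    rw [h f.toHomUnits.ker inferInstance]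
    trivial
  simpa using congrArg Units.val (MonoidHom.mem_ker.mp hg)

/-- Matrices over a finitely generated domain receive no nontrivial homomorphism from a group
without proper subgroups of finite index. -/
theorem MonoidHom.matrix_eq_one_of_finiteType_int {G A ι : Type*} [Group G] [CommRing A]
    [IsDomain A] [Algebra.FiniteType ℤ A] [Fintype ι] [DecidableEq ι]
    (h : ∀ H : Subgroup G, H.FiniteIndex → H = ⊤) (f : G →* Matrix ι ι A) (g : G) :
    f g = 1 := by
  have := Int.isJacobsonRing
  have : IsJacobsonRing A := isJacobsonRing_of_finiteType (A := ℤ)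
  ext i j
  rw [← sub_eq_zero]
  refine IsDomain.eq_zero_of_forall_mem_isMaximal fun m hm => ?_
  let := Ideal.Quotient.field m
  have : Algebra.FiniteType ℤ (A ⧸ m) :=
    Algebra.FiniteType.of_surjective (Ideal.Quotient.mkₐ ℤ m) (Ideal.Quotient.mkₐ_surjective ℤ m)
  have := Field.finite_of_finiteType_int (A ⧸ m)
  have hmap : (Ideal.Quotient.mk m).mapMatrix (f g) = 1 :=
    MonoidHom.eq_one_of_finite h ((Ideal.Quotient.mk m).mapMatrix.toMonoidHom.comp f) g
  rw [← map_one (Ideal.Quotient.mk m).mapMatrix] at hmap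
  exact Ideal.Quotient.eq.mp (congrFun (congrFun hmap i) j)

/-- A linear representation of a finitely generated group has all its matrix entries in a
finitely generated subring. -/
theorem Group.FG.exists_subalgebra_entries_mem {G F ι : Type*} [Group G] [Group.FG G]
    [CommRing F] [Fintype ι] [DecidableEq ι] (f : G →* Matrix ι ι F) :
    ∃ A : Subalgebra ℤ F, A.FG ∧ ∀ g i j, f g i j ∈ A := by
  obtain ⟨S, hS⟩ := Group.FG.out (G := G)
  let T : Set F := ⋃ s ∈ S, ⋃ i, ⋃ j, {f s i j, f s⁻¹ i j}
  have hT : T.Finite := S.finite_toSet.biUnion fun s _ =>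
    Set.finite_iUnion fun i => Set.finite_iUnion fun j => Set.toFinite _
  refine ⟨Algebra.adjoin ℤ T, Subalgebra.fg_def.mpr ⟨T, hT, rfl⟩, fun g => ?_⟩
  have hg : g ∈ Subgroup.closure (S : Set G) := hS ▸ Subgroup.mem_top g
  suffices H : ∀ i j, f g i j ∈ Algebra.adjoin ℤ T ∧ f g⁻¹ i j ∈ Algebra.adjoin ℤ T from
    fun i j => (H i j).1
  induction hg using Subgroup.closure_induction with
  | mem s hs =>
    refine fun i j => ⟨Algebra.subset_adjoin ?_, Algebra.subset_adjoin ?_⟩ <;>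
    · simp only [T, Set.mem_iUnion]
      exact ⟨s, hs, i, j, by simp⟩
  | one =>
    intro i j
    rw [inv_one, map_one, and_self, Matrix.one_apply]
    split_ifs
    exacts [one_mem _, zero_mem _]
  | mul x y _ _ hx hy =>
    intro i j
    rw [mul_inv_rev, map_mul, map_mul, Matrix.mul_apply, Matrix.mul_apply]
    exact ⟨sum_mem fun k _ => mul_mem (hx i k).1 (hy k j).1,
      sum_mem fun k _ => mul_mem (hy i k).2 (hx k j).2⟩
  | inv x _ hx =>
    intro i j
    rw [inv_inv]
    exact (hx i j).symm

/-- Let `G` be a finitely generated group with no proper subgroups of finite index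
(every finite-index subgroup equals `G`).  Then for every field `F`, every `n`,
every group homomorphism `ρ : G → GL_n(F)` is trivial. -/
theorem stmt2 {G : Type*} [Group G] [Group.FG G]
    (h : ∀ H : Subgroup G, H.FiniteIndex → H = ⊤)
    (F : Type u) [Field F] (n : ℕ)
    (ρ : G →* Matrix.GeneralLinearGroup (Fin n) F) (g : G) :
    ρ g = 1 := by
  obtain ⟨A, hA, hmem⟩ :=
    Group.FG.exists_subalgebra_entries_mem ((Units.coeHom _).comp ρ)
  have : Algebra.FiniteType ℤ A := A.fg_iff_finiteType.mp hA
  let f : G →* Matrix (Fin n) (Fin n) A :=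
    { toFun := fun x => Matrix.of fun i j => ⟨ρ x i j, hmem x i j⟩
      map_one' := by
        ext i j
        by_cases hij : i = j <;> simp [Matrix.one_apply, hij]
      map_mul' := fun x y => by
        ext i j
        simp [Matrix.mul_apply] }
  ext i j
  have hij := congrArg Subtype.val
    (congrFun (congrFun (MonoidHom.matrix_eq_one_of_finiteType_int h f g) i) j)
  refine hij.trans ?_
  by_cases heq : i = j <;> simp [Matrix.one_apply, heq]
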